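/- Let (f^{i,j}, g^j) (1 ≤ i,j ≤ m) be càdlàg and satisfy hypotheses (H), and suppose there is a unique continuous non-decreasing c : [0,∞) → [0,∞)^m with c(0) = 0 satisfying the differential inequality (d1). Fix i and suppose that for some 0 ≤ s < t and x ≥ 0, c^i is constant equal to x on [s,t], c^i(r) < x for r ∈ [0,s), and c^i(r) > x for r ∈ (t,∞) (i.e. the right-continuous inverse of c^i is discontinuous at x). Then f^{i,i} is continuous at x, and for every j ≠ i the composition f^{j,i} ∘ c^j is left-continuous at s: lim_{r↑s} f^{j,i}(c^j(r)) = f^{j,i}(c^j(s)). -/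

import Mathlib

open MeasureTheory Filter Function Set
open scoped ENNReal Topology

noncomputable section

/-- A function is càdlàg on `[0, τ)`: right-continuous at every `t ∈ [0, τ)` and with
left limits at every `t ∈ (0, τ)` (times are compared with `τ : ℝ≥0∞` via `ENNReal.ofReal`). -/
def CadlagOn (f : ℝ → ℝ) (τ : ℝ≥0∞) : Prop :=
  (∀ t : ℝ, 0 ≤ t → ENNReal.ofReal t < τ →
    Tendsto f (nhdsWithin t (Set.Ioi t)) (nhds (f t))) ∧
  (∀ t : ℝ, 0 < t → ENNReal.ofReal t < τ →
    ∃ l : ℝ, Tendsto f (nhdsWithin t (Set.Iio t)) (nhds l))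

/-- Càdlàg on all of `[0, ∞)`. -/
def Cadlag (f : ℝ → ℝ) : Prop := CadlagOn f ⊤

/-- Hypotheses (H) on the driving functions of the time-change system. -/
structure HypH (m : ℕ) (f : Fin m → Fin m → ℝ → ℝ) (g : Fin m → ℝ → ℝ) : Prop where
  cadlag_f : ∀ i j, Cadlag (f i j)
  cadlag_g : ∀ j, Cadlag (g j)
  /-- H1: the diagonal entries have no negative jumps -/
  no_neg_jumps : ∀ i, ∀ t : ℝ, 0 < t → Function.leftLim (f i i) t ≤ f i i t
  /-- H1: the off-diagonal entries are non-decreasing -/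
  mono_f : ∀ i j, i ≠ j → MonotoneOn (f i j) (Set.Ici 0)
  /-- H2 -/
  mono_g : ∀ j, MonotoneOn (g j) (Set.Ici 0)
  /-- H3 -/
  init_nonneg : ∀ j, 0 ≤ g j 0 + ∑ i, f i j 0

/-- The primitive `c(t) = ∫_0^t h(s) ds`. -/
def prim (h : ℝ → ℝ) (t : ℝ) : ℝ := ∫ s in (0:ℝ)..t, h s

/-- `h` solves the time-change system `h^j = Σ_i f^{i,j}∘c^i + g^j` on `[0, τ)`,
where `c^i` is the primitive of `h^i`. -/
def IsSolutionOn (m : ℕ) (f : Fin m → Fin m → ℝ → ℝ) (g : Fin m → ℝ → ℝ)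
    (τ : ℝ≥0∞) (h : Fin m → ℝ → ℝ) : Prop :=
  (∀ j, CadlagOn (h j) τ) ∧
  ∀ j, ∀ t : ℝ, 0 ≤ t → ENNReal.ofReal t < τ →
    h j t = (∑ i, f i j (prim (h i) t)) + g j t

/-- Non-negativity of a solution on `[0, τ)`. -/
def NonnegOn (m : ℕ) (τ : ℝ≥0∞) (h : Fin m → ℝ → ℝ) : Prop :=
  ∀ j, ∀ t : ℝ, 0 ≤ t → ENNReal.ofReal t < τ → 0 ≤ h j t

/-- The primitive of some coordinate of `h` tends to `∞` at `τ`. -/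
def ExplodesAt (m : ℕ) (τ : ℝ≥0∞) (h : Fin m → ℝ → ℝ) : Prop :=
  ∃ j : Fin m, ∀ M : ℝ, ∃ t : ℝ, 0 ≤ t ∧ ENNReal.ofReal t < τ ∧ M ≤ prim (h j) t

/-- A non-negative solution `h` of the time-change system on `[0, τ)` has no spontaneous
generation: whenever `h^j(s) = 0` for all `j ∈ J` and the primitive `c^j` increases strictly
at `s` for some `j ∈ J`, either `g^j` increases strictly to the right of `s`, or
`f^{i,j} ∘ c^i` increases strictly to the right of `s` for some `i ∉ J`. -/
def NoSpontGenOn (m : ℕ) (f : Fin m → Fin m → ℝ → ℝ) (g : Fin m → ℝ → ℝ)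
    (τ : ℝ≥0∞) (h : Fin m → ℝ → ℝ) : Prop :=
  ∀ s : ℝ, 0 ≤ s → ENNReal.ofReal s < τ →
    ∀ J : Finset (Fin m), (∀ j ∈ J, h j s = 0) →
      ∀ j ∈ J, (∀ t : ℝ, s < t → ENNReal.ofReal t < τ → prim (h j) s < prim (h j) t) →
        (∀ t : ℝ, s < t → ENNReal.ofReal t < τ → g j s < g j t) ∨
        ∃ i : Fin m, i ∉ J ∧
          ∀ t : ℝ, s < t → ENNReal.ofReal t < τ → f i j (prim (h i) s) < f i j (prim (h i) t)

/-- The left limit of a function, with the convention `f_−(x) = f(0)` for `x ≤ 0`. -/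
def lm (f : ℝ → ℝ) (x : ℝ) : ℝ := if 0 < x then Function.leftLim f x else f 0

/-- `c` is a continuous, non-decreasing solution, starting at `0`, of the differential
inequality (d1) on `[0, τ)`. -/
def IsD1Sol (m : ℕ) (f : Fin m → Fin m → ℝ → ℝ) (g : Fin m → ℝ → ℝ)
    (τ : ℝ≥0∞) (c : Fin m → ℝ → ℝ) : Prop :=
  (∀ j, c j 0 = 0) ∧
  (∀ j, ContinuousOn (c j) {t : ℝ | 0 ≤ t ∧ ENNReal.ofReal t < τ}) ∧
  (∀ j, MonotoneOn (c j) {t : ℝ | 0 ≤ t ∧ ENNReal.ofReal t < τ}) ∧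
  (∀ j, ∀ t : ℝ, 0 ≤ t → ENNReal.ofReal t < τ → 0 ≤ c j t) ∧
  (∀ j, ∀ r t : ℝ, 0 ≤ r → r ≤ t → ENNReal.ofReal t < τ →
    (∫ s in r..t, ((∑ i, lm (f i j) (c i s)) + g j s)) ≤ c j t - c j r ∧
    c j t - c j r ≤ ∫ s in r..t, ((∑ i, f i j (c i s)) + g j s))

/-- The discretization of time of span `σ`: `⌊s/σ⌋σ`, with the convention that it is
`s` itself when `σ = 0`. -/
def grid (σ s : ℝ) : ℝ := if σ = 0 then s else (⌊s / σ⌋ : ℝ) * σ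

/-- `c` is a solution of the Euler scheme of span `σ ≥ 0` (for `σ = 0`, of the exact
positive-part system). -/
def IsEulerSol (m : ℕ) (f : Fin m → Fin m → ℝ → ℝ) (g : Fin m → ℝ → ℝ)
    (σ : ℝ) (c : Fin m → ℝ → ℝ) : Prop :=
  ∀ j, ∀ t : ℝ, 0 ≤ t →
    c j t = ∫ s in (0:ℝ)..t, max 0 ((∑ i, f i j (c i (grid σ s))) + g j (grid σ s))

/-- An increasing homeomorphism of `[0, ∞)` onto itself (as a map `ℝ → ℝ`, only its
restriction to `[0,∞)` matters). -/
def IsTimeChange (lam : ℝ → ℝ) : Prop :=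
  lam 0 = 0 ∧ StrictMonoOn lam (Set.Ici 0) ∧ ContinuousOn lam (Set.Ici 0) ∧
  ∀ y : ℝ, 0 ≤ y → ∃ x : ℝ, 0 ≤ x ∧ lam x = y

/-- Convergence in the Skorohod J1 topology on `[0, ∞)`: there are time changes
`lam l` with `lam l − id → 0` and `k l − k ∘ lam l → 0` uniformly on compact sets. -/
def J1Tendsto (k : ℕ → ℝ → ℝ) (f : ℝ → ℝ) : Prop :=
  ∃ lam : ℕ → ℝ → ℝ, (∀ l, IsTimeChange (lam l)) ∧
    ∀ T ε : ℝ, 0 < ε → ∀ᶠ l in Filter.atTop, ∀ s : ℝ, 0 ≤ s → s ≤ T →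
      |lam l s - s| < ε ∧ |k l s - f (lam l s)| < ε

/-! ### Elementary facts on càdlàg functions without negative jumps -/

structure Good (φ : ℝ → ℝ) : Prop where
  rc : ∀ y, Tendsto φ (𝓝[>] y) (𝓝 (φ y))
  ll : ∀ y, Tendsto φ (𝓝[<] y) (𝓝 (leftLim φ y))
  nn : ∀ y, leftLim φ y ≤ φ y

lemma eventually_nhds_split {y : ℝ} {P : ℝ → Prop} (h1 : ∀ᶠ z in 𝓝[<] y, P z)
    (h2 : P y) (h3 : ∀ᶠ z in 𝓝[>] y, P z) : ∀ᶠ z in 𝓝 y, P z := by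
  rw [← nhdsLT_sup_nhdsGE, eventually_sup]
  refine ⟨h1, ?_⟩
  rw [← Ioi_insert, nhdsWithin_insert, eventually_sup]
  exact ⟨by simpa using h2, h3⟩

lemma Good.usc {φ : ℝ → ℝ} (h : Good φ) (y ε : ℝ) (hε : 0 < ε) :
    ∀ᶠ z in 𝓝 y, φ z < φ y + ε :=
  eventually_nhds_split ((h.ll y).eventually_lt_const (by linarith [h.nn y])) (by linarith)
    ((h.rc y).eventually_lt_const (by linarith))

lemma Good.lsc {φ : ℝ → ℝ} (h : Good φ) (y ε : ℝ) (hε : 0 < ε) :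
    ∀ᶠ z in 𝓝 y, leftLim φ y - ε < φ z :=
  eventually_nhds_split ((h.ll y).eventually_const_lt (by linarith)) (by linarith [h.nn y])
    ((h.rc y).eventually_const_lt (by linarith [h.nn y]))

lemma Good.measurable {φ : ℝ → ℝ} (h : Good φ) : Measurable φ := by
  apply UpperSemicontinuous.measurable
  intro y a ha
  filter_upwards [h.usc y (a - φ y) (by linarith)] with z hz
  linarith

lemma Good.measurable_leftLim {φ : ℝ → ℝ} (h : Good φ) : Measurable (leftLim φ) := by
  apply LowerSemicontinuous.measurable
  intro y a ha
  have := (h.lsc y ((leftLim φ y - a) / 2) (by linarith)).eventually_nhds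
  filter_upwards [this] with z hz
  have : leftLim φ y - (leftLim φ y - a) / 2 ≤ leftLim φ z :=
    ge_of_tendsto (h.ll z) ((hz.filter_mono nhdsWithin_le_nhds).mono fun _ h => h.le)
  linarith

lemma Good.bdd {φ : ℝ → ℝ} (h : Good φ) (y : ℝ) : ∃ M, ∀ᶠ z in 𝓝 y, |φ z| ≤ M := by
  refine ⟨max (φ y + 1) (-(leftLim φ y - 1)), ?_⟩
  filter_upwards [h.usc y 1 one_pos, h.lsc y 1 one_pos] with z h1 h2
  rw [abs_le]
  constructor
  · linarith [le_max_right (φ y + 1) (-(leftLim φ y - 1))]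
  · linarith [le_max_left (φ y + 1) (-(leftLim φ y - 1))]

lemma Good.bdd_leftLim {φ : ℝ → ℝ} (h : Good φ) (y : ℝ) :
    ∃ M, ∀ᶠ z in 𝓝 y, |leftLim φ z| ≤ M := by
  obtain ⟨M, hM⟩ := h.bdd y
  refine ⟨M, ?_⟩
  filter_upwards [hM.eventually_nhds] with z hz
  exact le_of_tendsto (h.ll z).abs (hz.filter_mono nhdsWithin_le_nhds)

lemma Good.leftCont {φ : ℝ → ℝ} (h : Good φ) (y : ℝ) :
    ContinuousWithinAt (leftLim φ) (Iic y) y :=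
  continuousWithinAt_leftLim_Iic (h.ll y)

lemma Good.rightCont {φ : ℝ → ℝ} (h : Good φ) (y : ℝ) :
    ContinuousWithinAt φ (Ici y) y :=
  continuousWithinAt_Ioi_iff_Ici.1 (h.rc y)

lemma locInt_comp {ψ w : ℝ → ℝ} (hψ : Measurable ψ)
    (hb : ∀ y, ∃ M, ∀ᶠ z in 𝓝 y, |ψ z| ≤ M) (hw : Continuous w) :
    LocallyIntegrable (fun u => ψ (w u)) := by
  intro u
  obtain ⟨M, hM⟩ := hb (w u)
  apply Measure.FiniteAtFilter.integrableAtFilter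
  · exact (hψ.comp hw.measurable).stronglyMeasurable.stronglyMeasurableAtFilter
  · exact volume.finiteAt_nhds u
  · refine ⟨M, ?_⟩
    simpa using hw.continuousAt.eventually hM

lemma LocInt.ii {ψ : ℝ → ℝ} (h : LocallyIntegrable ψ) (a b : ℝ) :
    IntervalIntegrable ψ volume a b :=
  (h.integrableOn_isCompact isCompact_uIcc).intervalIntegrable

/-- Right Dini upper bound. -/
def RD (W : ℝ → ℝ) (u ρ : ℝ) : Prop :=
  ∀ ε > 0, ∀ᶠ q in 𝓝[>] u, W q - W u ≤ (ρ + ε) * (q - u)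

/-- Left Dini lower bound. -/
def LD (W : ℝ → ℝ) (u ρ : ℝ) : Prop :=
  ∀ ε > 0, ∀ᶠ r in 𝓝[<] u, (ρ - ε) * (u - r) ≤ W u - W r

lemma RD.mono {W : ℝ → ℝ} {u ρ ρ' : ℝ} (h : RD W u ρ) (hρ : ρ ≤ ρ') : RD W u ρ' := by
  intro ε hε
  filter_upwards [h ε hε, self_mem_nhdsWithin] with q hq hq2
  have : 0 < q - u := sub_pos.2 hq2
  nlinarith

lemma LD.mono {W : ℝ → ℝ} {u ρ ρ' : ℝ} (h : LD W u ρ) (hρ : ρ' ≤ ρ) : LD W u ρ' := by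
  intro ε hε
  filter_upwards [h ε hε, self_mem_nhdsWithin] with q hq hq2
  have : 0 < u - q := sub_pos.2 hq2
  nlinarith

lemma RD.nonneg {W : ℝ → ℝ} {u ρ : ℝ} (h : RD W u ρ) (hW : Monotone W) : 0 ≤ ρ := by
  by_contra hn
  push Not at hn
  obtain ⟨q, hq1, hq2⟩ := ((h (-ρ / 2) (by linarith)).and self_mem_nhdsWithin).exists
  have h1 : 0 < q - u := sub_pos.2 hq2
  have h2 := hW (le_of_lt (mem_Ioi.1 hq2))
  nlinarith

lemma RD.integral_le {W ψ : ℝ → ℝ} {a b : ℝ} (hab : a ≤ b) (hW : ContinuousOn W (Icc a b))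
    (hψ : LocallyIntegrable ψ) (hr : ∀ u ∈ Ico a b, ContinuousWithinAt ψ (Ici u) u)
    (h : ∀ u ∈ Ico a b, RD W u (ψ u)) : W b - W a ≤ ∫ u in a..b, ψ u := by
  have key := image_le_of_liminf_slope_right_le_deriv_boundary (f := W) (a := a) (b := b) hW
    (B := fun u => W a + ∫ x in a..u, ψ x) (B' := ψ) (by simp) ?_ ?_ ?_ (right_mem_Icc.2 hab)
  · linarith
  · exact continuousOn_const.add
      (intervalIntegral.continuous_primitive (LocInt.ii hψ) a).continuousOn
  · intro x hx
    apply HasDerivWithinAt.const_add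
    exact intervalIntegral.integral_hasDerivWithinAt_right (LocInt.ii hψ a x)
      (hψ.aestronglyMeasurable.stronglyMeasurableAtFilter)
      ((hr x hx).mono Ioi_subset_Ici_self)
  · intro x hx r hxr
    apply Eventually.frequently
    filter_upwards [h x hx ((r - ψ x) / 2) (by linarith), self_mem_nhdsWithin] with q hq hq2
    have h1 : 0 < q - x := sub_pos.2 hq2
    rw [slope_def_field, div_lt_iff₀ h1]
    nlinarith

lemma RD.le_const {W : ℝ → ℝ} {a b M : ℝ} (hab : a ≤ b) (hW : Continuous W)
    (h : ∀ u ∈ Ico a b, RD W u M) : W b - W a ≤ M * (b - a) := by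
  have := RD.integral_le (ψ := fun _ => M) hab hW.continuousOn (locallyIntegrable_const M)
    (fun u _ => continuousWithinAt_const) h
  simpa [mul_comm] using this

lemma RD.of_integral {W ψ : ℝ → ℝ} {u b : ℝ} (hub : u < b)
    (hψ : LocallyIntegrable ψ) (hr : ContinuousWithinAt ψ (Ici u) u)
    (h : ∀ q ∈ Icc u b, W q - W u ≤ ∫ p in u..q, ψ p) : RD W u (ψ u) := by
  intro ε hε
  have h1 : ∀ᶠ p in 𝓝[≥] u, ψ p < ψ u + ε := hr.eventually_lt_const (by linarith)
  obtain ⟨d, hd, hd'⟩ := (mem_nhdsGE_iff_exists_Ico_subset (a := u)).1 h1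
  filter_upwards [Ioo_mem_nhdsGT hub, Ioo_mem_nhdsGT (mem_Ioi.1 hd)] with q hq hq'
  refine (h q ⟨hq.1.le, hq.2.le⟩).trans ?_
  have : ∫ p in u..q, ψ p ≤ ∫ p in u..q, (ψ u + ε) := by
    apply intervalIntegral.integral_mono_on hq.1.le (LocInt.ii hψ _ _) (by simp)
    intro p hp
    exact (hd' ⟨hp.1, hp.2.trans_lt hq'.2⟩ : ψ p < ψ u + ε).le
  refine this.trans (le_of_eq ?_)
  rw [intervalIntegral.integral_const, smul_eq_mul]
  ring

lemma LD.of_integral {W ψ : ℝ → ℝ} {u b : ℝ} (hub : b < u)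
    (hψ : LocallyIntegrable ψ) (hr : ContinuousWithinAt ψ (Iic u) u)
    (h : ∀ q ∈ Icc b u, ∫ p in q..u, ψ p ≤ W u - W q) : LD W u (ψ u) := by
  intro ε hε
  have h1 : ∀ᶠ p in 𝓝[≤] u, ψ u - ε < ψ p := hr.eventually_const_lt (by linarith)
  obtain ⟨d, hd, hd'⟩ := (mem_nhdsLE_iff_exists_Ioc_subset (a := u)).1 h1
  filter_upwards [Ioo_mem_nhdsLT hub, Ioo_mem_nhdsLT (mem_Iio.1 hd)] with q hq hq'
  refine le_trans ?_ (h q ⟨hq.1.le, hq.2.le⟩)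
  have : ∫ p in q..u, (ψ u - ε) ≤ ∫ p in q..u, ψ p := by
    apply intervalIntegral.integral_mono_on hq.2.le (by simp) (LocInt.ii hψ _ _)
    intro p hp
    exact (hd' ⟨hq'.1.trans_le hp.1, hp.2⟩ : ψ u - ε < ψ p).le
  refine le_trans (le_of_eq ?_) this
  rw [intervalIntegral.integral_const, smul_eq_mul]
  ring

lemma LD.le_integral {W ψ : ℝ → ℝ} {a b : ℝ} (hab : a ≤ b) (hW : ContinuousOn W (Icc a b))
    (hψ : LocallyIntegrable ψ) (hr : ∀ u ∈ Ioc a b, ContinuousWithinAt ψ (Iic u) u)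
    (h : ∀ u ∈ Ioc a b, LD W u (ψ u)) : ∫ u in a..b, ψ u ≤ W b - W a := by
  have hψ' : LocallyIntegrable (fun u => - ψ (-u)) := by
    apply LocallyIntegrable.neg
    intro x
    have := hψ (-x)
    obtain ⟨s, hs, hi⟩ := this
    refine ⟨Neg.neg ⁻¹' s, continuous_neg.continuousAt.preimage_mem_nhds hs, ?_⟩
    exact ((Measure.measurePreserving_neg (volume : Measure ℝ)).integrableOn_comp_preimage
      (Homeomorph.neg ℝ).measurableEmbedding).2 hi
  have key := RD.integral_le (W := fun u => W (-u)) (ψ := fun u => - ψ (-u)) (a := -b) (b := -a)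
    (by linarith) (hW.comp continuousOn_neg ?_) hψ' ?_ ?_
  · simp only [neg_neg, intervalIntegral.integral_neg] at key
    rw [intervalIntegral.integral_comp_neg (fun u => ψ u)] at key
    simp only [neg_neg] at key
    linarith
  · intro u hu
    exact ⟨by linarith [hu.2], by linarith [hu.1]⟩
  · intro u hu
    apply ContinuousWithinAt.neg
    refine ContinuousWithinAt.comp (t := Iic (-u)) (hr (-u) ⟨by linarith [hu.2], by linarith [hu.1]⟩)
      continuous_neg.continuousWithinAt ?_
    intro z hz
    simpa using hz
  · intro u hu ε hε
    have h1 := h (-u) ⟨by linarith [hu.2], by linarith [hu.1]⟩ ε hε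
    have h2 : Tendsto (fun q : ℝ => -q) (𝓝[>] u) (𝓝[<] (-u)) := tendsto_neg_nhdsGT
    filter_upwards [h2.eventually h1] with q hq
    linarith

/-! ### The core comparison argument -/

/-- Driving functions extended to the whole line. -/
structure Core (m : ℕ) (φ : Fin m → Fin m → ℝ → ℝ) (γ : Fin m → ℝ → ℝ) : Prop where
  gf : ∀ k j, Good (φ k j)
  gg : ∀ j, Good (γ j)
  mf : ∀ k j, k ≠ j → Monotone (φ k j)
  mg : ∀ j, Monotone (γ j)

/-- The off-diagonal part of the rate. -/
def Soff {m : ℕ} (φ : Fin m → Fin m → ℝ → ℝ) (γ : Fin m → ℝ → ℝ) (j : Fin m)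
    (w : Fin m → ℝ → ℝ) (u : ℝ) : ℝ :=
  (∑ k ∈ Finset.univ.erase j, φ k j (w k u)) + γ j u

/-- The off-diagonal part of the lower rate. -/
def Slow {m : ℕ} (φ : Fin m → Fin m → ℝ → ℝ) (γ : Fin m → ℝ → ℝ) (j : Fin m)
    (w : Fin m → ℝ → ℝ) (u : ℝ) : ℝ :=
  (∑ k ∈ Finset.univ.erase j, leftLim (φ k j) (w k u)) + leftLim (γ j) u

/-- Subsolutions below `v`. -/
structure Cls {m : ℕ} (φ : Fin m → Fin m → ℝ → ℝ) (γ : Fin m → ℝ → ℝ)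
    (v : Fin m → ℝ → ℝ) (w : Fin m → ℝ → ℝ) : Prop where
  mono : ∀ j, Monotone (w j)
  cont : ∀ j, Continuous (w j)
  zero : ∀ j u, u ≤ 0 → w j u = 0
  le : ∀ j u, w j u ≤ v j u
  rd : ∀ j u, RD (w j) u (φ j j (w j u) + Soff φ γ j w u)

section core
variable {m : ℕ} {φ : Fin m → Fin m → ℝ → ℝ} {γ : Fin m → ℝ → ℝ} {v : Fin m → ℝ → ℝ}

lemma Soff_le (hC : Core m φ γ) {j : Fin m} {w w' : Fin m → ℝ → ℝ} {u u' : ℝ}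
    (hw : ∀ k, k ≠ j → w k u ≤ w' k u') (hu : u ≤ u') : Soff φ γ j w u ≤ Soff φ γ j w' u' := by
  unfold Soff
  refine add_le_add (Finset.sum_le_sum fun k hk => ?_) (hC.mg j hu)
  have hk' := Finset.ne_of_mem_erase hk
  exact hC.mf k j hk' (hw k hk')

lemma Slow_le (hC : Core m φ γ) {j : Fin m} {w w' : Fin m → ℝ → ℝ} {u u' : ℝ}
    (hw : ∀ k, k ≠ j → w k u ≤ w' k u') (hu : u ≤ u') : Slow φ γ j w u ≤ Slow φ γ j w' u' := by
  unfold Slow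
  refine add_le_add (Finset.sum_le_sum fun k hk => ?_) ((hC.mg j).leftLim hu)
  have hk' := Finset.ne_of_mem_erase hk
  exact (hC.mf k j hk').leftLim (hw k hk')

lemma comp_right {ψ w : ℝ → ℝ} (hψ : Good ψ) (hm : Monotone w) (hc : Continuous w) (u : ℝ) :
    ContinuousWithinAt (fun u => ψ (w u)) (Ici u) u :=
  ContinuousWithinAt.comp (t := Ici (w u)) (hψ.rightCont (w u)) hc.continuousWithinAt
    (fun _ hz => hm hz)

lemma comp_left {ψ w : ℝ → ℝ} (hψ : Good ψ) (hm : Monotone w) (hc : Continuous w) (u : ℝ) :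
    ContinuousWithinAt (fun u => leftLim ψ (w u)) (Iic u) u :=
  ContinuousWithinAt.comp (t := Iic (w u)) (hψ.leftCont (w u)) hc.continuousWithinAt
    (fun _ hz => hm hz)

lemma Soff_right (hC : Core m φ γ) (j : Fin m) {w : Fin m → ℝ → ℝ} (hm : ∀ j, Monotone (w j))
    (hc : ∀ j, Continuous (w j)) (u : ℝ) : ContinuousWithinAt (Soff φ γ j w) (Ici u) u := by
  unfold Soff
  refine ContinuousWithinAt.add ?_ ((hC.gg j).rightCont u)
  exact tendsto_finsetSum _ fun k _ => comp_right (hC.gf k j) (hm k) (hc k) u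

lemma Soff_lsc (hC : Core m φ γ) (j : Fin m) {w : Fin m → ℝ → ℝ}
    (hc : ∀ j, Continuous (w j)) (u ε : ℝ) (hε : 0 < ε) :
    ∀ᶠ r in 𝓝 u, Slow φ γ j w u - ε ≤ Soff φ γ j w r := by
  have hε' : 0 < ε / (m + 1) := by positivity
  have h1 : ∀ᶠ r in 𝓝 u, ∀ k, leftLim (φ k j) (w k u) - ε / (m + 1) < φ k j (w k r) :=
    eventually_all.2 fun k => (hc k).continuousAt.eventually ((hC.gf k j).lsc (w k u) _ hε')
  filter_upwards [h1, (hC.gg j).lsc u _ hε'] with r h1 h2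
  unfold Soff Slow
  have h3 : ∑ k ∈ Finset.univ.erase j, (leftLim (φ k j) (w k u) - ε / (m + 1)) ≤
      ∑ k ∈ Finset.univ.erase j, φ k j (w k r) := Finset.sum_le_sum fun k _ => (h1 k).le
  rw [Finset.sum_sub_distrib, Finset.sum_const, nsmul_eq_mul] at h3
  have h4 : ((Finset.univ.erase j).card : ℝ) ≤ m := by
    have := Finset.card_le_univ (Finset.univ.erase j)
    rw [Fintype.card_fin] at this
    exact_mod_cast this
  have h5 : ((Finset.univ.erase j).card : ℝ) * (ε / (m + 1)) ≤ m * (ε / (m + 1)) := by gcongr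
  have h6 : m * (ε / (m + 1)) + ε / (m + 1) = ε := by field_simp
  linarith

/-- Compactness: a good function is bounded above on compact intervals. -/
lemma Good.bddOn {ψ : ℝ → ℝ} (h : Good ψ) (a b : ℝ) : ∃ M, ∀ z ∈ Icc a b, ψ z ≤ M := by
  have := IsCompact.induction_on (s := Icc a b) isCompact_Icc
    (p := fun s => ∃ M, ∀ z ∈ s, ψ z ≤ M) ⟨0, by simp⟩
    (fun s t hst ⟨M, hM⟩ => ⟨M, fun z hz => hM z (hst hz)⟩)
    (fun s t ⟨M, hM⟩ ⟨M', hM'⟩ => ⟨max M M', fun z hz => by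
      rcases hz with hz | hz
      · exact (hM z hz).trans (le_max_left _ _)
      · exact (hM' z hz).trans (le_max_right _ _)⟩)
    (fun x _ => ⟨_, mem_nhdsWithin_of_mem_nhds (h.usc x 1 one_pos), ψ x + 1,
      fun z hz => le_of_lt hz⟩)
  exact this

lemma Cls.nonneg {w : Fin m → ℝ → ℝ} (hw : Cls φ γ v w) (j : Fin m) (u : ℝ) : 0 ≤ w j u := by
  rcases le_total u 0 with h | h
  · exact (hw.zero j u h).ge
  · rw [← hw.zero j 0 le_rfl]; exact hw.mono j h

lemma Cls.lip (hC : Core m φ γ) (hv : ∀ j, Monotone (v j)) (j : Fin m) (T : ℝ) :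
    ∃ K > 0, ∀ w, Cls φ γ v w → ∀ r q, r ≤ q → q ≤ T → w j q - w j r ≤ K * (q - r) := by
  obtain ⟨M, hM⟩ := (hC.gf j j).bddOn 0 (v j T)
  refine ⟨max 1 (M + Soff φ γ j v T), by positivity, fun w hw r q hrq hqT => ?_⟩
  apply RD.le_const hrq (hw.cont j)
  intro u hu
  have huT : u ≤ T := hu.2.le.trans hqT
  refine (hw.rd j u).mono (le_trans ?_ (le_max_right _ _))
  refine add_le_add (hM _ ⟨hw.nonneg j u, (hw.le j u).trans (hv j huT)⟩) ?_
  exact Soff_le hC (fun k _ => (hw.le k u).trans (hv k huT)) huT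

/-- The largest subsolution below `v`. -/
def topSol (φ : Fin m → Fin m → ℝ → ℝ) (γ : Fin m → ℝ → ℝ) (v : Fin m → ℝ → ℝ)
    (j : Fin m) (u : ℝ) : ℝ := ⨆ w : {w // Cls φ γ v w}, w.1 j u

lemma le_topSol {w : Fin m → ℝ → ℝ} (hw : Cls φ γ v w) (j : Fin m) (u : ℝ) :
    w j u ≤ topSol φ γ v j u := by
  refine le_ciSup (f := fun w : {w // Cls φ γ v w} => w.1 j u) ?_ ⟨w, hw⟩
  exact ⟨v j u, by rintro _ ⟨w', rfl⟩; exact w'.2.le j u⟩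

lemma topSol_cls (hC : Core m φ γ) (hv : ∀ j, Monotone (v j)) {c : Fin m → ℝ → ℝ}
    (hc : Cls φ γ v c) : Cls φ γ v (topSol φ γ v) := by
  have : Nonempty {w // Cls φ γ v w} := ⟨⟨c, hc⟩⟩
  have hmono : ∀ j, Monotone (topSol φ γ v j) := fun j a b hab =>
    ciSup_le fun w => (w.2.mono j hab).trans (le_topSol w.2 j b)
  have hlip : ∀ j T, ∃ K > 0, ∀ r q, r ≤ q → q ≤ T →
      topSol φ γ v j q - topSol φ γ v j r ≤ K * (q - r) := by
    intro j T
    obtain ⟨K, hK, h⟩ := Cls.lip hC hv j T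
    refine ⟨K, hK, fun r q hrq hqT => ?_⟩
    rw [sub_le_iff_le_add]
    refine ciSup_le fun w => ?_
    linarith [h w.1 w.2 r q hrq hqT, le_topSol w.2 j r]
  have hcont : ∀ j, Continuous (topSol φ γ v j) := by
    intro j
    rw [continuous_iff_continuousAt]
    intro u
    obtain ⟨K, hK, h⟩ := hlip j (u + 1)
    refine continuousAt_of_locally_lipschitz one_pos K fun z hz => ?_
    rw [Real.dist_eq, abs_lt] at hz
    rw [Real.dist_eq, Real.dist_eq]
    rcases le_total z u with hzu | hzu
    · rw [abs_of_nonpos (by linarith [hmono j hzu]), abs_of_nonpos (by linarith)]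
      linarith [h z u hzu (by linarith)]
    · rw [abs_of_nonneg (by linarith [hmono j hzu]), abs_of_nonneg (by linarith)]
      linarith [h u z hzu (by linarith)]
  refine ⟨hmono, hcont, ?_, ?_, ?_⟩
  · intro j u hu
    unfold topSol
    rw [show (fun w : {w // Cls φ γ v w} => w.1 j u) = fun _ => 0 from
      funext fun w => w.2.zero j u hu]
    exact ciSup_const
  · exact fun j u => ciSup_le fun w => w.2.le j u
  · intro j u ε hε
    set y := topSol φ γ v with hy
    set Y := y j u with hY
    obtain ⟨η, hη, hη'⟩ := Metric.eventually_nhds_iff.1 ((hC.gf j j).usc Y (ε / 2) (by linarith))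
    obtain ⟨K, hK, hlipw⟩ := Cls.lip hC hv j (u + 1)
    have hS : ∀ᶠ p in 𝓝[≥] u, Soff φ γ j y p < Soff φ γ j y u + ε / 2 :=
      (Soff_right hC j hmono hcont u).eventually_lt_const (by linarith)
    obtain ⟨d, hd, hd'⟩ := (mem_nhdsGE_iff_exists_Ico_subset (a := u)).1 hS
    set M := φ j j Y + Soff φ γ j y u + ε with hM
    have e1 : ∀ᶠ q in 𝓝[>] u, K * (q - u) < η / 4 := by
      have : Tendsto (fun q => K * (q - u)) (𝓝 u) (𝓝 (K * (u - u))) := by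
        apply Continuous.tendsto (by fun_prop)
      exact (this.mono_left nhdsWithin_le_nhds).eventually_lt_const (by simpa using by linarith)
    have e2 : ∀ᶠ q in 𝓝[>] u, -(η / 4) < M * (q - u) := by
      have : Tendsto (fun q => M * (q - u)) (𝓝 u) (𝓝 (M * (u - u))) := by
        apply Continuous.tendsto (by fun_prop)
      exact (this.mono_left nhdsWithin_le_nhds).eventually_const_lt (by simpa using by linarith)
    filter_upwards [e1, e2, Ioo_mem_nhdsGT (mem_Ioi.1 hd),
      Ioo_mem_nhdsGT (show u < u + 1 by linarith)] with q h1 h2 h3 h4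
    rw [sub_le_iff_le_add]
    refine ciSup_le fun w => ?_
    obtain ⟨w, hw⟩ := w
    simp only
    have hwu : w j u ≤ Y := le_topSol hw j u
    rcases le_or_gt (w j u) (Y - η / 2) with hcase | hcase
    · have := hlipw w hw u q h3.1.le h4.2.le
      linarith
    · have : w j q - w j u ≤ M * (q - u) := by
        apply RD.le_const h3.1.le (hw.cont j)
        intro p hp
        refine (hw.rd j p).mono ?_
        have a1 : φ j j (w j p) < φ j j Y + ε / 2 := by
          apply hη'
          rw [Real.dist_eq, abs_lt]
          have b1 := hw.mono j hp.1
          have b2 := hlipw w hw u p hp.1 (hp.2.le.trans h4.2.le)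
          have b3 : K * (p - u) ≤ K * (q - u) := by
            apply mul_le_mul_of_nonneg_left _ hK.le
            linarith [hp.2]
          constructor <;> linarith
        have a2 : Soff φ γ j w p ≤ Soff φ γ j y p := Soff_le hC (fun k _ => le_topSol hw k p) le_rfl
        have a3 : Soff φ γ j y p < Soff φ γ j y u + ε / 2 := hd' ⟨hp.1, hp.2.trans h3.2⟩
        linarith
      linarith

/-- Local upward modification of a subsolution. -/
lemma bump (hC : Core m φ γ) (hv : ∀ j, Monotone (v j)) {w : Fin m → ℝ → ℝ}
    (hw : Cls φ γ v w) (j : Fin m) (u₁ a h : ℝ) (hu₁ : 0 ≤ u₁) (ha : 0 ≤ a) (hh : 0 ≤ h)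
    (h1 : ∀ u ∈ Icc u₁ (u₁ + h), a ≤ φ j j (w j u₁ + a * (u - u₁)) + Soff φ γ j w u)
    (h2 : w j u₁ + a * h ≤ v j u₁) :
    ∃ w', Cls φ γ v w' ∧ w j u₁ + a * h ≤ w' j (u₁ + h) := by
  classical
  set L : ℝ → ℝ := fun u => w j (min u u₁) + a * max 0 (min (u - u₁) h) with hL
  have hLc : Continuous L := by
    have := hw.cont j
    fun_prop
  have hLm : Monotone L := by
    intro x y hxy
    have := hw.mono j (min_le_min_right u₁ hxy)
    simp only [hL]
    gcongr
  have hL0 : ∀ u ≤ u₁, L u = w j u := by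
    intro u hu
    simp only [hL]
    rw [min_eq_left hu, max_eq_left ((min_le_left _ _).trans (by linarith))]
    simp
  have hL1 : ∀ u ∈ Icc u₁ (u₁ + h), L u = w j u₁ + a * (u - u₁) := by
    intro u hu
    simp only [hL]
    rw [min_eq_right hu.1, min_eq_left (by linarith [hu.2]), max_eq_right (by linarith [hu.1])]
  have hL2 : ∀ u, u₁ + h ≤ u → L u = w j u₁ + a * h := by
    intro u hu
    simp only [hL]
    rw [min_eq_right (by linarith), min_eq_right (by linarith), max_eq_right hh]
  set w' : Fin m → ℝ → ℝ := Function.update w j (fun u => max (w j u) (L u)) with hw'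
  have hj : w' j = fun u => max (w j u) (L u) := by simp [hw']
  have hk : ∀ k, k ≠ j → w' k = w k := fun k hkj => by simp [hw', hkj]
  have hge : ∀ k u, w k u ≤ w' k u := by
    intro k u
    by_cases hkj : k = j
    · subst hkj; rw [hj]; exact le_max_left _ _
    · rw [hk k hkj]
  refine ⟨w', ⟨?_, ?_, ?_, ?_, ?_⟩, ?_⟩
  · intro k
    by_cases hkj : k = j
    · subst hkj; rw [hj]; exact (hw.mono k).max hLm
    · rw [hk k hkj]; exact hw.mono k
  · intro k
    by_cases hkj : k = j
    · subst hkj; rw [hj]; exact (hw.cont k).max hLc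
    · rw [hk k hkj]; exact hw.cont k
  · intro k u hu
    by_cases hkj : k = j
    · subst hkj; rw [hj]; simp only; rw [hL0 u (by linarith), max_self]; exact hw.zero k u hu
    · rw [hk k hkj]; exact hw.zero k u hu
  · intro k u
    by_cases hkj : k = j
    · subst hkj; rw [hj]
      refine max_le (hw.le k u) ?_
      rcases le_total u u₁ with hu | hu
      · rw [hL0 u hu]; exact hw.le k u
      · calc L u ≤ L (max u (u₁ + h)) := hLm (le_max_left _ _)
          _ = w k u₁ + a * h := hL2 _ (le_max_right _ _)
          _ ≤ v k u₁ := h2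
          _ ≤ v k u := hv k hu
    · rw [hk k hkj]; exact hw.le k u
  · intro k u
    by_cases hkj : k = j
    · subst hkj
      have hS : Soff φ γ k w' u = Soff φ γ k w u :=
        le_antisymm (Soff_le hC (fun i hi => by rw [hk i hi]) le_rfl)
          (Soff_le hC (fun i hi => by rw [hk i hi]) le_rfl)
      rw [hS, hj]
      simp only
      rcases lt_or_ge u u₁ with hu | hu
      · rw [hL0 u hu.le, max_self]
        intro ε hε
        filter_upwards [hw.rd k u ε hε, Ioo_mem_nhdsGT hu] with q hq hq'
        rw [hL0 u hu.le, hL0 q hq'.2.le, max_self, max_self]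
        exact hq
      · have hLrd : RD L u (φ k k (L u) + Soff φ γ k w u) := by
          intro ε hε
          rcases lt_or_ge u (u₁ + h) with huh | huh
          · filter_upwards [Ioo_mem_nhdsGT huh] with q hq
            have b := h1 u ⟨hu, huh.le⟩
            rw [hL1 u ⟨hu, huh.le⟩, hL1 q ⟨hu.trans hq.1.le, hq.2.le⟩]
            have : 0 < q - u := sub_pos.2 hq.1
            nlinarith
          · have b := h1 (u₁ + h) ⟨by linarith, le_rfl⟩
            have b2 : Soff φ γ k w (u₁ + h) ≤ Soff φ γ k w u :=
              Soff_le hC (fun i _ => hw.mono i huh) huh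
            rw [add_sub_cancel_left] at b
            filter_upwards [self_mem_nhdsWithin] with q hq
            have hq' : u < q := hq
            rw [hL2 u huh, hL2 q (by linarith)]
            have : 0 < q - u := sub_pos.2 hq'
            rw [sub_self]
            apply mul_nonneg _ this.le
            linarith
        intro ε hε
        rcases lt_trichotomy (w k u) (L u) with hlt | heq | hgt
        · have e : ∀ᶠ q in 𝓝[>] u, w k q < L q :=
            (((hw.cont k).tendsto u).eventually_lt (hLc.tendsto u) hlt).filter_mono
              nhdsWithin_le_nhds
          filter_upwards [e, hLrd ε hε] with q h3 h4
          rw [max_eq_right hlt.le, max_eq_right h3.le]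
          exact h4
        · filter_upwards [hw.rd k u ε hε, hLrd ε hε] with q h3 h4
          rw [heq] at h3
          rw [heq, max_self]
          rcases max_choice (w k q) (L q) with h5 | h5 <;> rw [h5]
          · exact h3
          · exact h4
        · have e : ∀ᶠ q in 𝓝[>] u, L q < w k q :=
            ((hLc.tendsto u).eventually_lt ((hw.cont k).tendsto u) hgt).filter_mono
              nhdsWithin_le_nhds
          filter_upwards [e, hw.rd k u ε hε] with q h3 h4
          rw [max_eq_left hgt.le, max_eq_left h3.le]
          exact h4
    · rw [hk k hkj]
      exact (hw.rd k u).mono (add_le_add le_rfl (Soff_le hC (fun i _ => hge i u) le_rfl))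
  · rw [hj]
    refine le_trans (le_of_eq ?_) (le_max_right _ _)
    rw [hL2 _ le_rfl]

/-- The largest subsolution satisfies the lower differential inequality. -/
lemma topSol_ld (hC : Core m φ γ) (hv : ∀ j, Monotone (v j)) (hvc : ∀ j, Continuous (v j))
    (hvl : ∀ j u, 0 < u → LD (v j) u (leftLim (φ j j) (v j u) + Slow φ γ j v u))
    (hy : Cls φ γ v (topSol φ γ v)) (j : Fin m) (u : ℝ) (hu : 0 < u) :
    LD (topSol φ γ v j) u (leftLim (φ j j) (topSol φ γ v j u) + Slow φ γ j (topSol φ γ v) u) := by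
  set y := topSol φ γ v with hydef
  set G := leftLim (φ j j) (y j u) + Slow φ γ j y u with hG
  rcases (hy.le j u).eq_or_lt with heq | hlt
  · intro ε hε
    have hGv : G ≤ leftLim (φ j j) (v j u) + Slow φ γ j v u := by
      rw [hG, heq]
      exact add_le_add le_rfl (Slow_le hC (fun k _ => hy.le k u) le_rfl)
    filter_upwards [((hvl j u hu).mono hGv) ε hε] with r hr
    linarith [hy.le j r]
  · intro ε hε
    rcases le_or_gt (G - ε) 0 with ha | ha
    · filter_upwards [self_mem_nhdsWithin] with r hr
      have hr' : r < u := hr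
      have := hy.mono j hr'.le
      nlinarith
    · by_contra hcon
      rw [not_eventually] at hcon
      set a := G - ε with hadef
      obtain ⟨η, hη, hη'⟩ := Metric.eventually_nhds_iff.1
        ((hC.gf j j).lsc (y j u) (ε / 2) (by linarith))
      obtain ⟨d, hd, hd'⟩ := Metric.eventually_nhds_iff.1
        (Soff_lsc hC j hy.cont u (ε / 2) (by linarith))
      have e1 : ∀ᶠ r in 𝓝[<] u, a * (u - r) < η := by
        have : Tendsto (fun q => a * (u - q)) (𝓝 u) (𝓝 (a * (u - u))) := by
          apply Continuous.tendsto (by fun_prop)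
        exact (this.mono_left nhdsWithin_le_nhds).eventually_lt_const (by simpa using hη)
      have e2 : ∀ᶠ r in 𝓝[<] u, y j u - η < y j r :=
        (((hy.cont j).tendsto u).mono_left nhdsWithin_le_nhds).eventually_const_lt (by linarith)
      have e3 : ∀ᶠ r in 𝓝[<] u, y j r + a * (u - r) < v j r := by
        have t1 : Tendsto (fun r => y j r + a * (u - r)) (𝓝 u) (𝓝 (y j u + a * (u - u))) := by
          have := hy.cont j
          apply Continuous.tendsto (by fun_prop)
        exact (t1.eventually_lt ((hvc j).tendsto u) (by simpa using hlt)).filter_mono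
          nhdsWithin_le_nhds
      have e4 : ∀ᶠ r in 𝓝[<] u, r ∈ Ioo 0 u := Ioo_mem_nhdsLT hu
      have e5 : ∀ᶠ r in 𝓝[<] u, r ∈ Ioo (u - d) u :=
        Ioo_mem_nhdsLT (show u - d < u by linarith)
      obtain ⟨r, hr0, hr1, hr2, hr3, hr4, hr5⟩ := (hcon.and_eventually (e1.and (e2.and (e3.and
        (e4.and e5))))).exists
      push Not at hr0
      obtain ⟨w', hw', hge⟩ := bump hC hv hy j r a (u - r) hr4.1.le ha.le
        (by linarith [hr4.2]) (by
          intro p hp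
          have hp2 : p ≤ u := by linarith [hp.2]
          have b1 : leftLim (φ j j) (y j u) - ε / 2 < φ j j (y j r + a * (p - r)) := by
            apply hη'
            rw [Real.dist_eq, abs_lt]
            have c1 : 0 ≤ a * (p - r) := mul_nonneg ha.le (by linarith [hp.1])
            have c2 : a * (p - r) ≤ a * (u - r) := mul_le_mul_of_nonneg_left (by linarith) ha.le
            have c3 := hy.mono j hr4.2.le
            constructor <;> linarith
          have b2 : Slow φ γ j y u - ε / 2 ≤ Soff φ γ j y p := by
            apply hd'
            rw [Real.dist_eq, abs_lt]
            constructor <;> linarith [hp.1, hr5.1]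
          linarith) hr3.le
      rw [add_sub_cancel] at hge
      have := le_topSol hw' j u
      linarith

end core

/-! ### Transfer to the original system -/

lemma ext_ll {f : ℝ → ℝ} (hf : Cadlag f) (y : ℝ) :
    Tendsto (fun y => f (max y 0)) (𝓝[<] y) (𝓝 (lm f y)) := by
  unfold lm
  split_ifs with h
  · obtain ⟨l, hl⟩ := hf.2 y h (by simp)
    rw [leftLim_eq_of_tendsto hl]
    refine hl.congr' ?_
    filter_upwards [Ioo_mem_nhdsLT h] with z hz
    rw [max_eq_left hz.1.le]
  · refine tendsto_const_nhds.congr' ?_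
    filter_upwards [self_mem_nhdsWithin] with z hz
    have hz' : z < y := hz
    rw [max_eq_right (by linarith)]

lemma ext_leftLim {f : ℝ → ℝ} (hf : Cadlag f) (y : ℝ) :
    leftLim (fun y => f (max y 0)) y = lm f y :=
  leftLim_eq_of_tendsto (ext_ll hf y)

lemma ext_good {f : ℝ → ℝ} (hf : Cadlag f) (hn : ∀ y, 0 < y → leftLim f y ≤ f y) :
    Good (fun y => f (max y 0)) := by
  refine ⟨?_, ?_, ?_⟩
  · intro y
    rcases lt_or_ge y 0 with h | h
    · refine tendsto_const_nhds.congr' ?_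
      filter_upwards [Ioo_mem_nhdsGT h] with z hz
      rw [max_eq_right h.le, max_eq_right hz.2.le]
    · rw [max_eq_left h]
      refine (hf.1 y h (by simp)).congr' ?_
      filter_upwards [self_mem_nhdsWithin] with z hz
      have hz' : y < z := hz
      rw [max_eq_left (by linarith)]
  · intro y
    rw [ext_leftLim hf]
    exact ext_ll hf y
  · intro y
    rw [ext_leftLim hf]
    unfold lm
    split_ifs with h
    · rw [max_eq_left h.le]; exact hn y h
    · rw [max_eq_right (by linarith)]

lemma ext_mono {f : ℝ → ℝ} (hf : MonotoneOn f (Ici 0)) : Monotone (fun y => f (max y 0)) :=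
  fun _ _ h => hf (mem_Ici.2 (le_max_right _ _)) (mem_Ici.2 (le_max_right _ _))
    (max_le_max_right 0 h)

lemma mono_leftLim_le {f : ℝ → ℝ} (hf : Cadlag f) (hm : MonotoneOn f (Ici 0)) (y : ℝ)
    (hy : 0 < y) : leftLim f y ≤ f y := by
  have h1 := ext_ll hf y
  rw [lm, if_pos hy] at h1
  refine le_of_tendsto h1 ?_
  filter_upwards [self_mem_nhdsWithin] with z hz
  have := ext_mono hm (le_of_lt (mem_Iio.1 hz))
  simp only at this
  rwa [max_eq_left hy.le] at this

lemma core_of_H {m : ℕ} {f : Fin m → Fin m → ℝ → ℝ} {g : Fin m → ℝ → ℝ} (hH : HypH m f g) :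
    Core m (fun k j y => f k j (max y 0)) (fun j u => g j (max u 0)) where
  gf k j := by
    refine ext_good (hH.cadlag_f k j) ?_
    by_cases hkj : k = j
    · subst hkj; exact hH.no_neg_jumps k
    · exact mono_leftLim_le (hH.cadlag_f k j) (hH.mono_f k j hkj)
  gg j := ext_good (hH.cadlag_g j) (mono_leftLim_le (hH.cadlag_g j) (hH.mono_g j))
  mf k j hkj := ext_mono (hH.mono_f k j hkj)
  mg j := ext_mono (hH.mono_g j)

section rates
variable {m : ℕ} {φ : Fin m → Fin m → ℝ → ℝ} {γ : Fin m → ℝ → ℝ}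

lemma rate_eq (j : Fin m) (w : Fin m → ℝ → ℝ) (u : ℝ) :
    φ j j (w j u) + Soff φ γ j w u = (∑ k, φ k j (w k u)) + γ j u := by
  unfold Soff
  rw [← add_assoc, Finset.add_sum_erase _ (fun k => φ k j (w k u)) (Finset.mem_univ j)]

lemma lrate_eq (j : Fin m) (w : Fin m → ℝ → ℝ) (u : ℝ) :
    leftLim (φ j j) (w j u) + Slow φ γ j w u =
      (∑ k, leftLim (φ k j) (w k u)) + leftLim (γ j) u := by
  unfold Slow
  rw [← add_assoc, Finset.add_sum_erase _ (fun k => leftLim (φ k j) (w k u)) (Finset.mem_univ j)]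

lemma rate_li (hC : Core m φ γ) (j : Fin m) {w : Fin m → ℝ → ℝ} (hc : ∀ k, Continuous (w k)) :
    LocallyIntegrable (fun u => (∑ k, φ k j (w k u)) + γ j u) := by
  refine LocallyIntegrable.add (locallyIntegrable_finsetSum _ fun k _ => ?_) ?_
  · exact locInt_comp (hC.gf k j).measurable (hC.gf k j).bdd (hc k)
  · exact locInt_comp (hC.gg j).measurable (hC.gg j).bdd continuous_id

lemma lrate_li (hC : Core m φ γ) (j : Fin m) {w : Fin m → ℝ → ℝ} (hc : ∀ k, Continuous (w k)) :
    LocallyIntegrable (fun u => (∑ k, leftLim (φ k j) (w k u)) + leftLim (γ j) u) := by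
  refine LocallyIntegrable.add (locallyIntegrable_finsetSum _ fun k _ => ?_) ?_
  · exact locInt_comp (hC.gf k j).measurable_leftLim (hC.gf k j).bdd_leftLim (hc k)
  · exact locInt_comp (hC.gg j).measurable_leftLim (hC.gg j).bdd_leftLim continuous_id

lemma rate_rc (hC : Core m φ γ) (j : Fin m) {w : Fin m → ℝ → ℝ} (hc : ∀ k, Continuous (w k))
    (hm : ∀ k, Monotone (w k)) (u : ℝ) :
    ContinuousWithinAt (fun u => (∑ k, φ k j (w k u)) + γ j u) (Ici u) u :=
  ContinuousWithinAt.add (tendsto_finsetSum _ fun k _ => comp_right (hC.gf k j) (hm k) (hc k) u)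
    ((hC.gg j).rightCont u)

lemma lrate_lc (hC : Core m φ γ) (j : Fin m) {w : Fin m → ℝ → ℝ} (hc : ∀ k, Continuous (w k))
    (hm : ∀ k, Monotone (w k)) (u : ℝ) :
    ContinuousWithinAt (fun u => (∑ k, leftLim (φ k j) (w k u)) + leftLim (γ j) u) (Iic u) u :=
  ContinuousWithinAt.add (tendsto_finsetSum _ fun k _ => comp_left (hC.gf k j) (hm k) (hc k) u)
    ((hC.gg j).leftCont u)

lemma leftLim_ae (hC : Core m φ γ) (j : Fin m) : ∀ᵐ u : ℝ, leftLim (γ j) u = γ j u := by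
  have h := (hC.mg j).countable_not_continuousAt.ae_notMem volume
  filter_upwards [h] with u hu
  simp only [not_not] at hu
  exact hu.continuousWithinAt.leftLim_eq

end rates

section transfer
variable {m : ℕ} {f : Fin m → Fin m → ℝ → ℝ} {g : Fin m → ℝ → ℝ}

lemma up_congr (j : Fin m) {w : Fin m → ℝ → ℝ} {r q : ℝ} (hr : 0 ≤ r) (hrq : r ≤ q)
    (hw : ∀ k u, 0 ≤ u → 0 ≤ w k u) :
    ∫ s in r..q, ((∑ k, f k j (w k s)) + g j s) =
      ∫ s in r..q, ((∑ k, f k j (max (w k (max s 0)) 0)) + g j (max s 0)) := by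
  apply intervalIntegral.integral_congr
  intro s hs
  rw [uIcc_of_le hrq] at hs
  have h0 : 0 ≤ s := hr.trans hs.1
  simp only [max_eq_left h0, max_eq_left (hw _ s h0)]

lemma low_congr (hH : HypH m f g) (j : Fin m) {w : Fin m → ℝ → ℝ} {r q : ℝ} (hr : 0 ≤ r)
    (hrq : r ≤ q) :
    ∫ s in r..q, ((∑ k, lm (f k j) (w k s)) + g j s) =
      ∫ s in r..q, ((∑ k, leftLim (fun y => f k j (max y 0)) (w k (max s 0))) +
        leftLim (fun u => g j (max u 0)) s) := by
  apply intervalIntegral.integral_congr_ae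
  filter_upwards [leftLim_ae (core_of_H hH) j] with s hs2 hs
  rw [uIoc_of_le hrq] at hs
  have h0 : 0 ≤ s := hr.trans hs.1.le
  rw [hs2]
  simp only [max_eq_left h0, ext_leftLim (hH.cadlag_f _ j)]

lemma d1_of_cls (hH : HypH m f g) {v y : Fin m → ℝ → ℝ}
    (hy : Cls (fun k j y => f k j (max y 0)) (fun j u => g j (max u 0)) v y)
    (hl : ∀ j u, 0 < u → LD (y j) u (leftLim (fun z => f j j (max z 0)) (y j u) +
      Slow (fun k j y => f k j (max y 0)) (fun j u => g j (max u 0)) j y u)) :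
    IsD1Sol m f g ⊤ y := by
  have hC := core_of_H hH
  refine ⟨fun j => hy.zero j 0 le_rfl, fun j => (hy.cont j).continuousOn,
    fun j => (hy.mono j).monotoneOn _, fun j t _ _ => hy.nonneg j t, ?_⟩
  intro j r t hr hrt _
  have hyy : ∀ k s, y k (max s 0) = y k s := by
    intro k s
    rcases le_total s 0 with h | h
    · rw [max_eq_right h, hy.zero k s h, hy.zero k 0 le_rfl]
    · rw [max_eq_left h]
  constructor
  · rw [low_congr hH j hr hrt]
    simp only [hyy]
    apply LD.le_integral hrt (hy.cont j).continuousOn (lrate_li hC j hy.cont)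
      (fun u _ => lrate_lc hC j hy.cont hy.mono u)
    intro u hu
    rw [← lrate_eq (φ := fun k j y => f k j (max y 0)) (γ := fun j u => g j (max u 0))]
    exact hl j u (hr.trans_lt hu.1)
  · rw [up_congr j hr hrt (fun k u _ => hy.nonneg k u)]
    simp only [hyy]
    apply RD.integral_le hrt (hy.cont j).continuousOn (rate_li hC j hy.cont)
      (fun u _ => rate_rc hC j hy.cont hy.mono u)
    intro u hu
    rw [← rate_eq (φ := fun k j y => f k j (max y 0)) (γ := fun j u => g j (max u 0))]
    exact hy.rd j u

lemma d1_cont {c : Fin m → ℝ → ℝ} (hc : IsD1Sol m f g ⊤ c) (j : Fin m) :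
    Continuous (fun u => c j (max u 0)) := by
  have h := hc.2.1 j
  exact h.comp_continuous (by fun_prop) (fun u => ⟨le_max_right _ _, by simp⟩)

lemma d1_mono {c : Fin m → ℝ → ℝ} (hc : IsD1Sol m f g ⊤ c) (j : Fin m) :
    Monotone (fun u => c j (max u 0)) := by
  intro a b hab
  exact hc.2.2.1 j ⟨le_max_right _ _, by simp⟩ ⟨le_max_right _ _, by simp⟩ (max_le_max_right 0 hab)

lemma d1_rd (hH : HypH m f g) {c : Fin m → ℝ → ℝ} (hc : IsD1Sol m f g ⊤ c) (j : Fin m) (u : ℝ) :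
    RD (fun u => c j (max u 0)) u ((fun z => f j j (max z 0)) (c j (max u 0)) +
      Soff (fun k j y => f k j (max y 0)) (fun j u => g j (max u 0)) j
        (fun k u => c k (max u 0)) u) := by
  have hC := core_of_H hH
  have hr := rate_eq (φ := fun k j y => f k j (max y 0)) (γ := fun j u => g j (max u 0)) j
    (fun k u => c k (max u 0)) u
  simp only at hr ⊢
  rw [hr]
  rcases lt_or_ge u 0 with hu | hu
  · intro ε hε
    filter_upwards [Ioo_mem_nhdsGT hu] with q hq
    have h3 := hH.init_nonneg j
    simp only [max_eq_right hu.le, max_eq_right hq.2.le, hc.1, max_self, sub_self]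
    apply mul_nonneg _ (by linarith [hq.1])
    linarith
  · apply RD.of_integral (ψ := fun u => (∑ k, f k j (max (c k (max u 0)) 0)) + g j (max u 0))
      (show u < u + 1 by linarith) (rate_li hC j (d1_cont hc)) (rate_rc hC j (d1_cont hc) (d1_mono hc) u)
    intro q hq
    have h := (hc.2.2.2.2 j u q hu hq.1 (by simp)).2
    rw [up_congr j hu hq.1 (fun k u h => hc.2.2.2.1 k u h (by simp))] at h
    rw [max_eq_left hu, max_eq_left (hu.trans hq.1)]
    exact h

lemma d1_ld (hH : HypH m f g) {c : Fin m → ℝ → ℝ} (hc : IsD1Sol m f g ⊤ c) (j : Fin m) (u : ℝ)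
    (hu : 0 < u) :
    LD (fun u => c j (max u 0)) u (leftLim (fun z => f j j (max z 0)) (c j (max u 0)) +
      Slow (fun k j y => f k j (max y 0)) (fun j u => g j (max u 0)) j
        (fun k u => c k (max u 0)) u) := by
  have hC := core_of_H hH
  have hr := lrate_eq (φ := fun k j y => f k j (max y 0)) (γ := fun j u => g j (max u 0)) j
    (fun k u => c k (max u 0)) u
  rw [hr]
  apply LD.of_integral (ψ := fun u => (∑ k, leftLim (fun y => f k j (max y 0)) (c k (max u 0))) +
      leftLim (fun u => g j (max u 0)) u)
    hu (lrate_li hC j (d1_cont hc)) (lrate_lc hC j (d1_cont hc) (d1_mono hc) u)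
  intro q hq
  have h := (hc.2.2.2.2 j q u hq.1 hq.2 (by simp)).1
  rw [low_congr hH j hq.1 hq.2] at h
  rw [max_eq_left hu.le, max_eq_left hq.1]
  exact h

/-- The key consequence of uniqueness: the rate of `c^i` at the beginning of a flat stretch
is non-positive. -/
lemma rate_nonpos (hH : HypH m f g)
    (c : Fin m → ℝ → ℝ) (hc : IsD1Sol m f g ⊤ c)
    (huniq : ∀ c' : Fin m → ℝ → ℝ, IsD1Sol m f g ⊤ c' →
      ∀ j, ∀ t : ℝ, 0 ≤ t → c' j t = c j t)
    (i : Fin m) (s t x : ℝ) (hs : 0 ≤ s) (hst : s < t)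
    (hconst : ∀ r : ℝ, s ≤ r → r ≤ t → c i r = x)
    (hafter : ∀ r : ℝ, t < r → x < c i r) :
    (fun z => f i i (max z 0)) (c i (max s 0)) +
      Soff (fun k j y => f k j (max y 0)) (fun j u => g j (max u 0)) i
        (fun k u => c k (max u 0)) s ≤ 0 := by
  have hC := core_of_H hH
  set φ : Fin m → Fin m → ℝ → ℝ := fun k j y => f k j (max y 0) with hφ
  set γ : Fin m → ℝ → ℝ := fun j u => g j (max u 0) with hγ
  set C : Fin m → ℝ → ℝ := fun k u => c k (max u 0) with hCdef
  have hCm : ∀ j, Monotone (C j) := d1_mono hc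
  have hCc : ∀ j, Continuous (C j) := d1_cont hc
  have hrd : ∀ j u, RD (C j) u (φ j j (C j u) + Soff φ γ j C u) := d1_rd hH hc
  have hld : ∀ j u, 0 < u → LD (C j) u (leftLim (φ j j) (C j u) + Slow φ γ j C u) := d1_ld hH hc
  set δ := t - s with hδ
  have hδ0 : 0 < δ := by linarith
  set v : Fin m → ℝ → ℝ := fun k u => C k (u + δ) with hv
  have hvm : ∀ j, Monotone (v j) := fun j a b hab => hCm j (by linarith)
  have hvc : ∀ j, Continuous (v j) := fun j => (hCc j).comp (by fun_prop)
  have hvl : ∀ j u, 0 < u → LD (v j) u (leftLim (φ j j) (v j u) + Slow φ γ j v u) := by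
    intro j u hu
    have h1 := hld j (u + δ) (by linarith)
    have h2 : leftLim (φ j j) (v j u) + Slow φ γ j v u ≤
        leftLim (φ j j) (C j (u + δ)) + Slow φ γ j C (u + δ) :=
      add_le_add le_rfl (Slow_le hC (fun k _ => le_rfl) (by linarith))
    intro ε hε
    have h3 := h1.mono h2 ε hε
    have h4 : Tendsto (fun r => r + δ) (𝓝[<] u) (𝓝[<] (u + δ)) := by
      apply tendsto_nhdsWithin_of_tendsto_nhds_of_eventually_within
      · exact (Continuous.tendsto (by fun_prop) u).mono_left nhdsWithin_le_nhds
      · filter_upwards [self_mem_nhdsWithin] with r hr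
        have hr' : r < u := hr
        simpa using hr'
    filter_upwards [h4.eventually h3] with r hr
    rw [add_sub_add_right_eq_sub] at hr
    exact hr
  have hcls : Cls φ γ v C := by
    refine ⟨hCm, hCc, ?_, fun j u => hCm j (by linarith), hrd⟩
    intro j u hu
    simp only [hCdef, max_eq_right hu, hc.1]
  have htop := topSol_cls hC hvm hcls
  have hd1 : IsD1Sol m f g ⊤ (topSol φ γ v) :=
    d1_of_cls hH htop (fun j u hu => topSol_ld hC hvm hvc hvl htop j u hu)
  have hmax : ∀ w, Cls φ γ v w → ∀ j u, 0 ≤ u → w j u ≤ c j u := fun w hw j u hu =>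
    (le_topSol hw j u).trans (huniq _ hd1 j u hu).le
  -- now suppose the rate is positive
  by_contra hpos
  push Not at hpos
  have hCs : C i s = x := by simp only [hCdef, max_eq_left hs]; exact hconst s le_rfl hst.le
  change 0 < φ i i (C i s) + Soff φ γ i C s at hpos
  rw [hCs] at hpos
  set a := (φ i i x + Soff φ γ i C s) / 2 with ha
  have ha0 : 0 < a := by linarith
  have h1 : ∀ᶠ z in 𝓝[≥] x, φ i i x - a < φ i i z :=
    ((hC.gf i i).rightCont x).eventually_const_lt (by linarith)
  obtain ⟨η, hη, hη'⟩ := (mem_nhdsGE_iff_exists_Ico_subset (a := x)).1 h1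
  have hη0 : x < η := hη
  set s₁ := (s + t) / 2 with hs₁
  have hvs : x < v i s₁ := by
    simp only [hv, hCdef]
    rw [max_eq_left (by linarith)]
    exact hafter _ (by linarith)
  have hCs₁ : C i s₁ = x := by
    simp only [hCdef]
    rw [max_eq_left (by linarith)]
    exact hconst _ (by linarith) (by linarith)
  set h := min ((t - s₁)) (min ((v i s₁ - x) / a) ((η - x) / (2 * a))) with hh
  have hh0 : 0 < h := by
    refine lt_min (by linarith) (lt_min (div_pos (by linarith) ha0) (div_pos (by linarith) (by linarith)))
  have hh1 : h ≤ t - s₁ := min_le_left _ _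
  have hh2 : a * h ≤ v i s₁ - x := by
    have : h ≤ (v i s₁ - x) / a := (min_le_right _ _).trans (min_le_left _ _)
    rw [le_div_iff₀ ha0] at this
    linarith
  have hh3 : a * h < η - x := by
    have : h ≤ (η - x) / (2 * a) := (min_le_right _ _).trans (min_le_right _ _)
    rw [le_div_iff₀ (by linarith)] at this
    linarith
  obtain ⟨w', hw', hge⟩ := bump hC hvm hcls i s₁ a h (by linarith) ha0.le hh0.le (by
    intro p hp
    rw [hCs₁]
    have b1 : 0 ≤ a * (p - s₁) := mul_nonneg ha0.le (by linarith [hp.1])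
    have b2 : a * (p - s₁) ≤ a * h := mul_le_mul_of_nonneg_left (by linarith [hp.2]) ha0.le
    have b3 : φ i i x - a < φ i i (x + a * (p - s₁)) := hη' ⟨by linarith, by linarith⟩
    have b4 : Soff φ γ i C s ≤ Soff φ γ i C p :=
      Soff_le hC (fun k _ => hCm k (by linarith [hp.1])) (by linarith [hp.1])
    linarith) (by rw [hCs₁]; linarith)
  have e1 := hmax w' hw' i (s₁ + h) (by linarith)
  rw [hconst (s₁ + h) (by linarith) (by linarith)] at e1
  rw [hCs₁] at hge
  have : 0 < a * h := mul_pos ha0 hh0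
  linarith

end transfer

/-- at a discontinuity of the right-continuous inverse of `c^i`,
the diagonal function `f^{i,i}` is continuous and the compositions `f^{j,i}∘c^j` are
left-continuous. -/
theorem stmt16 (m : ℕ) (hm : 1 ≤ m)
    (f : Fin m → Fin m → ℝ → ℝ) (g : Fin m → ℝ → ℝ) (hH : HypH m f g)
    (c : Fin m → ℝ → ℝ) (hc : IsD1Sol m f g ⊤ c)
    -- `c` is the unique continuous non-decreasing solution of (d1)
    (huniq : ∀ c' : Fin m → ℝ → ℝ, IsD1Sol m f g ⊤ c' →
      ∀ j, ∀ t : ℝ, 0 ≤ t → c' j t = c j t)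
    (i : Fin m) (s t x : ℝ) (hs : 0 ≤ s) (hst : s < t) (hx : 0 ≤ x)
    -- `c^i` is constant equal to `x` on `[s, t]`…
    (hconst : ∀ r : ℝ, s ≤ r → r ≤ t → c i r = x)
    -- …while `c^i < x` before `s` and `c^i > x` after `t`
    (hbefore : ∀ r : ℝ, 0 ≤ r → r < s → c i r < x)
    (hafter : ∀ r : ℝ, t < r → x < c i r) :
    ContinuousWithinAt (f i i) (Set.Ici 0) x ∧
    ∀ j, j ≠ i →
      Tendsto (fun r => f j i (c j r)) (nhdsWithin s (Set.Ico 0 s))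
        (nhds (f j i (c j s))) := by
  have hC := core_of_H hH
  have hle := rate_nonpos hH c hc huniq i s t x hs hst hconst hafter
  have hrd := d1_rd hH hc i
  set φ : Fin m → Fin m → ℝ → ℝ := fun k j y => f k j (max y 0) with hφ
  set γ : Fin m → ℝ → ℝ := fun j u => g j (max u 0) with hγ
  set C : Fin m → ℝ → ℝ := fun k u => c k (max u 0) with hCdef
  have hCm : ∀ j, Monotone (C j) := d1_mono hc
  have hCc : ∀ j, Continuous (C j) := d1_cont hc
  have hCs : C i s = x := by simp only [hCdef, max_eq_left hs]; exact hconst s le_rfl hst.le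
  change φ i i (C i s) + Soff φ γ i C s ≤ 0 at hle
  rw [hCs] at hle
  have hnn : ∀ r, 0 ≤ φ i i (C i r) + Soff φ γ i C r := fun r => (hrd r).nonneg (hCm i)
  rcases hs.eq_or_lt with hs0 | hs0
  · have hx0 : x = 0 := by
      rw [← hconst s le_rfl hst.le, ← hs0]; exact hc.1 i
    constructor
    · rw [hx0]
      exact continuousWithinAt_Ioi_iff_Ici.1 ((hH.cadlag_f i i).1 0 le_rfl (by simp))
    · intro j _
      rw [← hs0]
      simp
  · have hx0 : 0 < x := by
      have := hbefore 0 le_rfl hs0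
      rwa [hc.1] at this
    -- `c^i` tends to `x` strictly from below
    have hlim : Tendsto (C i) (𝓝[<] s) (𝓝[<] x) := by
      apply tendsto_nhdsWithin_of_tendsto_nhds_of_eventually_within
      · rw [← hCs]
        exact ((hCc i).tendsto s).mono_left nhdsWithin_le_nhds
      · filter_upwards [Ioo_mem_nhdsLT hs0] with r hr
        simp only [hCdef, max_eq_left hr.1.le]
        exact hbefore r hr.1.le hr.2
    have hlim2 : Tendsto (fun r => φ i i (C i r)) (𝓝[<] s) (𝓝 (leftLim (φ i i) x)) :=
      ((hC.gf i i).ll x).comp hlim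
    have hge : φ i i x ≤ leftLim (φ i i) x := by
      refine ge_of_tendsto hlim2 ?_
      filter_upwards [self_mem_nhdsWithin] with r hr
      have hr' : r < s := hr
      have h1 := hnn r
      have h2 : Soff φ γ i C r ≤ Soff φ γ i C s :=
        Soff_le hC (fun k _ => hCm k hr'.le) hr'.le
      linarith
    have heq : leftLim (φ i i) x = φ i i x := le_antisymm ((hC.gf i i).nn x) hge
    constructor
    · have hcont : ContinuousAt (φ i i) x := by
        rw [Metric.continuousAt_iff']
        intro ε hε
        filter_upwards [(hC.gf i i).usc x ε hε, (hC.gf i i).lsc x ε hε] with z h1 h2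
        rw [Real.dist_eq, abs_lt]
        rw [heq] at h2
        constructor <;> linarith
      refine hcont.continuousWithinAt.congr ?_ ?_
      · intro z hz
        have hz' : 0 ≤ z := hz
        simp only [hφ, max_eq_left hz']
      · simp only [hφ, max_eq_left hx]
    · intro j hj
      have hnw : 𝓝[Ico 0 s] s ≤ 𝓝[<] s := nhdsWithin_mono s fun z hz => hz.2
      have hcs0 : 0 ≤ c j s := hc.2.2.2.1 j s hs (by simp)
      have hup : Tendsto (fun _ : ℝ => φ j i (C j s)) (𝓝[Ico 0 s] s) (𝓝 (φ j i (C j s))) :=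
        tendsto_const_nhds
      have hdown : Tendsto (fun r => φ j i (C j s) - (φ i i (C i r) - φ i i x))
          (𝓝[Ico 0 s] s) (𝓝 (φ j i (C j s))) := by
        have := ((hlim2.mono_left hnw).sub_const (φ i i x)).const_sub (φ j i (C j s))
        rwa [heq, sub_self, sub_zero] at this
      have hres := tendsto_of_tendsto_of_tendsto_of_le_of_le'
        (f := fun r => φ j i (C j r)) hdown hup ?_ ?_
      · have hend : φ j i (C j s) = f j i (c j s) := by
          simp only [hφ, hCdef, max_eq_left hs, max_eq_left hcs0]
        rw [hend] at hres
        refine hres.congr' ?_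
        filter_upwards [self_mem_nhdsWithin] with r hr
        simp only [hφ, hCdef, max_eq_left hr.1, max_eq_left (hc.2.2.2.1 j r hr.1 (by simp))]
      · filter_upwards [self_mem_nhdsWithin] with r hr
        have h1 := hnn r
        have hjm : j ∈ Finset.univ.erase i := Finset.mem_erase.2 ⟨hj, Finset.mem_univ j⟩
        have h2 : φ j i (C j s) - φ j i (C j r) ≤
            ∑ k ∈ Finset.univ.erase i, (φ k i (C k s) - φ k i (C k r)) := by
          refine Finset.single_le_sum (f := fun k => φ k i (C k s) - φ k i (C k r)) ?_ hjm
          intro k hk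
          have := hC.mf k i (Finset.ne_of_mem_erase hk) (hCm k hr.2.le)
          linarith
        rw [Finset.sum_sub_distrib] at h2
        have h3 : γ i r ≤ γ i s := hC.mg i hr.2.le
        unfold Soff at h1 hle
        linarith
      · filter_upwards [self_mem_nhdsWithin] with r hr
        exact hC.mf j i hj (hCm j hr.2.le)
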